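/- Assume G is orderable and φ is cofinal. Then for all x, y ∈ G one has the Lipschitz estimates |c₊(x) - c₊(y)| ≤ d_spec(x, y) and |c₋(x) - c₋(y)| ≤ d_spec(x, y). (The selectors are 1-Lipschitz with respect to the spectral pseudo-distance; inequality (3.2) of the paper.) -/

import Mathlib

/-- The maximal order spectral selector `c₊`. -/
noncomputable def cplus {G : Type*} (r : G → G → Prop) (φ : ℝ → G) (ψ : G) : ℝ :=
  sInf {t : ℝ | r ψ (φ t)}

/-- The minimal order spectral selector `c₋`. -/
noncomputable def cminus {G : Type*} (r : G → G → Prop) (φ : ℝ → G) (ψ : G) : ℝ :=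
  sSup {t : ℝ | r (φ t) ψ}

/-- The spectral pseudo-distance `d_spec(x, y) = max (c₊(x*y⁻¹), c₊(y*x⁻¹))`. -/
noncomputable def dSpec {G : Type*} [Group G] (r : G → G → Prop) (φ : ℝ → G) (x y : G) : ℝ :=
  max (cplus r φ (x * y⁻¹)) (cplus r φ (y * x⁻¹))

section SpectralSelectors

variable {G : Type*} {r : G → G → Prop} {φ : ℝ → G}

/-- In an orderable group, an injective monotone flow reflects the order. -/
theorem le_of_rel_flow (hφinj : Function.Injective φ)
    (hφmono : ∀ s t : ℝ, s ≤ t → r (φ s) (φ t))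
    (horder : ∀ x y, r x y → r y x → x = y) {s t : ℝ} (h : r (φ s) (φ t)) : s ≤ t := by
  by_contra! hts
  exact hts.ne' (hφinj (horder _ _ h (hφmono _ _ hts.le)))

theorem bddBelow_setOf_rel_flow (htrans : ∀ x y z, r x y → r y z → r x z)
    (hφle : ∀ s t : ℝ, r (φ s) (φ t) → s ≤ t) {x : G} {s : ℝ} (hs : r (φ s) x) :
    BddBelow {t : ℝ | r x (φ t)} :=
  ⟨s, fun t ht => hφle s t (htrans _ _ _ hs ht)⟩

theorem bddAbove_setOf_flow_rel (htrans : ∀ x y z, r x y → r y z → r x z)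
    (hφle : ∀ s t : ℝ, r (φ s) (φ t) → s ≤ t) {x : G} {t : ℝ} (ht : r x (φ t)) :
    BddAbove {s : ℝ | r (φ s) x} :=
  ⟨t, fun s hs => hφle s t (htrans _ _ _ hs ht)⟩

variable [Group G]

/-- The maximal selector is subadditive. -/
theorem cplus_mul_le (htrans : ∀ x y z, r x y → r y z → r x z)
    (hbi : ∀ a b x y, r x y → r (a * x * b) (a * y * b))
    (hφadd : ∀ s t : ℝ, φ (s + t) = φ s * φ t)
    (hφle : ∀ s t : ℝ, r (φ s) (φ t) → s ≤ t)
    (hcof : ∀ ψ : G, ∃ s t : ℝ, r (φ s) ψ ∧ r ψ (φ t)) (a b : G) :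
    cplus r φ (a * b) ≤ cplus r φ a + cplus r φ b := by
  obtain ⟨_, ta, _, hta⟩ := hcof a
  obtain ⟨_, tb, _, htb⟩ := hcof b
  obtain ⟨_, _, hsab, _⟩ := hcof (a * b)
  rw [← sub_le_iff_le_add']
  refine le_csInf ⟨tb, htb⟩ fun t ht => ?_
  rw [sub_le_comm]
  refine le_csInf ⟨ta, hta⟩ fun s hs => ?_
  rw [sub_le_iff_le_add]
  refine csInf_le (bddBelow_setOf_rel_flow htrans hφle hsab) ?_
  have h₁ : r (a * b) (φ s * b) := by simpa using hbi 1 b _ _ hs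
  have h₂ : r (φ s * b) (φ s * φ t) := by simpa using hbi (φ s) 1 _ _ ht
  simpa only [Set.mem_ofPred_eq, hφadd] using htrans _ _ _ h₁ h₂

/-- Left multiplication by `a` raises the minimal selector by at most `c₊(a)`. -/
theorem cminus_mul_le (htrans : ∀ x y z, r x y → r y z → r x z)
    (hbi : ∀ a b x y, r x y → r (a * x * b) (a * y * b))
    (hφadd : ∀ s t : ℝ, φ (s + t) = φ s * φ t)
    (hφle : ∀ s t : ℝ, r (φ s) (φ t) → s ≤ t)
    (hcof : ∀ ψ : G, ∃ s t : ℝ, r (φ s) ψ ∧ r ψ (φ t)) (a b : G) :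
    cminus r φ (a * b) ≤ cplus r φ a + cminus r φ b := by
  obtain ⟨_, ta, _, hta⟩ := hcof a
  obtain ⟨_, _, _, htb⟩ := hcof b
  obtain ⟨sab, _, hsab, _⟩ := hcof (a * b)
  refine csSup_le ⟨sab, hsab⟩ fun t ht => ?_
  rw [← sub_le_iff_le_add]
  refine le_csInf ⟨ta, hta⟩ fun s hs => ?_
  rw [sub_le_comm]
  refine le_csSup (bddAbove_setOf_flow_rel htrans hφle htb) ?_
  have h₁ : r (φ t) (φ s * b) :=
    htrans _ _ _ ht (by simpa using hbi 1 b _ _ hs)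
  have h₂ : φ t = φ s * φ (t - s) := by rw [← hφadd, add_sub_cancel]
  rw [h₂] at h₁
  simpa using hbi (φ s)⁻¹ 1 _ _ h₁

end SpectralSelectors

/-- the selectors are 1-Lipschitz with respect to the spectral
pseudo-distance. -/
theorem stmt_10 {G : Type*} [Group G] (r : G → G → Prop)
    (hrefl : ∀ x, r x x)
    (htrans : ∀ x y z, r x y → r y z → r x z)
    (hbi : ∀ a b x y, r x y → r (a * x * b) (a * y * b))
    (φ : ℝ → G)
    (hφadd : ∀ s t : ℝ, φ (s + t) = φ s * φ t)
    (hφinj : Function.Injective φ)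
    (hφmono : ∀ s t : ℝ, s ≤ t → r (φ s) (φ t))
    (horder : ∀ x y, r x y → r y x → x = y)
    (hcof : ∀ ψ : G, ∃ s t : ℝ, r (φ s) ψ ∧ r ψ (φ t)) :
    ∀ x y : G,
      |cplus r φ x - cplus r φ y| ≤ dSpec r φ x y ∧
      |cminus r φ x - cminus r φ y| ≤ dSpec r φ x y := by
  have hφle : ∀ s t : ℝ, r (φ s) (φ t) → s ≤ t := fun _ _ =>
    le_of_rel_flow hφinj hφmono horder
  have hplus : ∀ x y, cplus r φ x - cplus r φ y ≤ cplus r φ (x * y⁻¹) := fun x y => by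
    simpa using cplus_mul_le htrans hbi hφadd hφle hcof (x * y⁻¹) y
  have hminus : ∀ x y, cminus r φ x - cminus r φ y ≤ cplus r φ (x * y⁻¹) := fun x y => by
    simpa using cminus_mul_le htrans hbi hφadd hφle hcof (x * y⁻¹) y
  intro x y
  constructor
  · exact max_le_max (hplus x y) (by simpa using hplus y x)
  · exact max_le_max (hminus x y) (by simpa using hminus y x)
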